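/- arXiv:1402.6096 — 2 statements merged into one kernel-verified Lean document; each statement's English description precedes it below -/
import Mathlib

section
/- Let G = (V, E) be a square grid graph of maximum degree at most 3, 2-colored black/white with n₁ black and n₂ white vertices (n = n₁ + n₂). Augment V with a set Q(V) of n points, one point q_v per vertex v, placed along a missing grid edge at v at distance 1/4 (if v is black) or 1/5 (if v is white) from v. Then G has a Hamiltonian path if and only if the point set V ∪ Q(V) admits a spanning tree of weight L = n − 1 + n₁/4 + n₂/5 in which the angular span at every point is at most π. -/
open Real

noncomputable section

abbrev Pl := EuclideanSpace ℝ (Fin 2)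

def pt (x y : ℝ) : Pl := (EuclideanSpace.equiv (Fin 2) ℝ).symm ![x, y]

def dir (θ : ℝ) : Pl := pt (Real.cos θ) (Real.sin θ)

/-- Wedge with apex `p`, bisector orientation `θ`, angular width `α`. -/
def wedge (p : Pl) (θ α : ℝ) : Set Pl :=
  {q | q = p ∨ InnerProductGeometry.angle (q - p) (dir θ) ≤ α / 2}

end

open scoped Classical in
/-- Total Euclidean edge weight of a geometric graph. -/
noncomputable def wt {V : Type*} [Fintype V] (G : SimpleGraph V) (pos : V → Pl) : ℝ :=
  (∑ p : V, ∑ q : V, if G.Adj p q then dist (pos p) (pos q) else 0) / 2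

theorem mem_wedge_pi_iff (p r : Pl) (θ : ℝ) :
    r ∈ wedge p θ π ↔ 0 ≤ (r 0 - p 0) * Real.cos θ + (r 1 - p 1) * Real.sin θ := by
  have hin : inner ℝ (r - p) (dir θ)
      = (r 0 - p 0) * Real.cos θ + (r 1 - p 1) * Real.sin θ := by
    simp [dir, pt, PiLp.inner_apply, Fin.sum_univ_two, mul_comm]
  rw [← hin]
  constructor
  · rintro (rfl | h)
    · simp
    · rw [← InnerProductGeometry.cos_angle_mul_norm_mul_norm]
      refine mul_nonneg (Real.cos_nonneg_of_neg_pi_div_two_le_of_le ?_ h) (by positivity)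
      linarith [InnerProductGeometry.angle_nonneg (r - p) (dir θ), Real.pi_pos]
  · intro h
    right
    exact Real.arccos_le_pi_div_two.2 (by positivity)

theorem dist_pt (a b c d : ℝ) : dist (pt a b) (pt c d) = √((a - c) ^ 2 + (b - d) ^ 2) := by
  simp [pt, EuclideanSpace.dist_eq, Fin.sum_univ_two, Real.dist_eq, sq_abs]

theorem pt_add_smul (a b c x y : ℝ) : pt a b + c • pt x y = pt (a + c * x) (b + c * y) := by
  ext i; fin_cases i <;> simp [pt]

theorem pt_inj {a b c d : ℝ} : pt a b = pt c d ↔ a = c ∧ b = d := by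
  constructor
  · intro h
    exact ⟨by simpa [pt] using congrArg (fun z : Pl => z 0) h,
      by simpa [pt] using congrArg (fun z : Pl => z 1) h⟩
  · rintro ⟨rfl, rfl⟩; rfl

/-- `(x, y)` is one of the four unit directions of the square grid. -/
def IsUnitStep (x y : ℤ) : Prop :=
  (x = 1 ∧ y = 0) ∨ (x = -1 ∧ y = 0) ∨ (x = 0 ∧ y = 1) ∨ (x = 0 ∧ y = -1)

theorem isUnitStep_iff (x y : ℤ) : IsUnitStep x y ↔ x ^ 2 + y ^ 2 = 1 := by
  constructor
  · rintro (⟨rfl, rfl⟩ | ⟨rfl, rfl⟩ | ⟨rfl, rfl⟩ | ⟨rfl, rfl⟩) <;> norm_num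
  · intro h
    have hx1 : x ≤ 1 := by nlinarith
    have hx2 : -1 ≤ x := by nlinarith
    have hy1 : y ≤ 1 := by nlinarith
    have hy2 : -1 ≤ y := by nlinarith
    unfold IsUnitStep
    interval_cases x <;> interval_cases y <;> simp_all

theorem one_lt_sq_add_sq_of_step {a b x y : ℤ} {c : ℝ} (hs : IsUnitStep x y) (hc0 : 0 < c)
    (hc : c ≤ 1 / 4) (h0 : ¬(a = 0 ∧ b = 0)) (h1 : ¬(a = x ∧ b = y)) :
    1 < (a - c * x) ^ 2 + (b - c * y) ^ 2 := by
  have hs' := (isUnitStep_iff x y).1 hs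
  have hN : 1 ≤ a ^ 2 + b ^ 2 := by
    by_contra hlt
    exact h0 ⟨by nlinarith, by nlinarith⟩
  have hxy : ((x : ℝ) ^ 2 + (y : ℝ) ^ 2) = 1 := by exact_mod_cast hs'
  have hd : 1 ≤ (a - x) ^ 2 + (b - y) ^ 2 := by
    by_contra hlt
    exact h1 ⟨by nlinarith, by nlinarith⟩
  have hNR : (1 : ℝ) ≤ (a : ℝ) ^ 2 + (b : ℝ) ^ 2 := by exact_mod_cast hN
  have hdR : (1 : ℝ) ≤ ((a : ℝ) - x) ^ 2 + ((b : ℝ) - y) ^ 2 := by exact_mod_cast hd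
  have expand : (a - c * x) ^ 2 + (b - c * y) ^ 2
      = (a : ℝ) ^ 2 + (b : ℝ) ^ 2 - 2 * (c * (a * x + b * y)) + c ^ 2 := by
    linear_combination c ^ 2 * hxy
  rw [expand]
  rcases le_or_gt (a * x + b * y) 0 with hm | hm
  · have hmR : (a : ℝ) * x + b * y ≤ 0 := by exact_mod_cast hm
    nlinarith [mul_nonneg hc0.le (neg_nonneg.2 hmR)]
  · have hmR : (1 : ℝ) ≤ (a : ℝ) * x + b * y := by exact_mod_cast hm
    nlinarith [mul_nonneg (sub_nonneg.2 hc) (zero_le_one.trans hmR)]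

theorem one_lt_sq_add_sq_of_two_steps {a b x y x' y' : ℤ} {c c' : ℝ} (hs : IsUnitStep x y)
    (hs' : IsUnitStep x' y') (hc : c = 1 / 4 ∨ c = 1 / 5) (hc' : c' = 1 / 4 ∨ c' = 1 / 5)
    (h0 : ¬(a = 0 ∧ b = 0)) (h1 : ¬(a = x ∧ b = y)) (h2 : ¬(a = -x' ∧ b = -y'))
    (hcc : IsUnitStep a b → c ≠ c') :
    1 < (a + c' * x' - c * x) ^ 2 + (b + c' * y' - c * y) ^ 2 := by
  have bound : ∀ {x : ℤ} {c : ℝ}, |x| ≤ 1 → (c = 1 / 4 ∨ c = 1 / 5) → |c * x| ≤ 1 / 4 := by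
    intro x c hx hc
    have hx' : |(x : ℝ)| ≤ 1 := by exact_mod_cast hx
    rw [abs_mul]
    rcases hc with rfl | rfl <;> norm_num <;> linarith
  have habs : ∀ {x y : ℤ}, IsUnitStep x y → |x| ≤ 1 ∧ |y| ≤ 1 := by
    rintro x y (⟨rfl, rfl⟩ | ⟨rfl, rfl⟩ | ⟨rfl, rfl⟩ | ⟨rfl, rfl⟩) <;> simp
  have far : ∀ {a x x' : ℤ}, |x| ≤ 1 → |x'| ≤ 1 → 2 ≤ |a| → 1 < (a + c' * x' - c * x) ^ 2 := by
    intro a x x' hx hx' ha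
    have h := abs_le.1 (bound hx hc)
    have h' := abs_le.1 (bound hx' hc')
    rcases le_abs'.1 ha with ha | ha
    · have : (a : ℝ) ≤ -2 := by exact_mod_cast ha
      nlinarith
    · have : (2 : ℝ) ≤ a := by exact_mod_cast ha
      nlinarith
  rcases le_or_gt 2 |a| with ha | ha
  · nlinarith [far (habs hs).1 (habs hs').1 ha, sq_nonneg (b + c' * y' - c * y)]
  rcases le_or_gt 2 |b| with hb | hb
  · nlinarith [far (habs hs).2 (habs hs').2 hb, sq_nonneg (a + c' * x' - c * x)]
  have ha' := abs_lt.1 ha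
  have hb' := abs_lt.1 hb
  obtain ⟨ha1, ha2⟩ := ha'
  obtain ⟨hb1, hb2⟩ := hb'
  clear far bound habs ha hb
  revert h0 h1 h2 hcc
  rcases hc with rfl | rfl <;> rcases hc' with rfl | rfl <;>
  rcases hs with ⟨rfl, rfl⟩ | ⟨rfl, rfl⟩ | ⟨rfl, rfl⟩ | ⟨rfl, rfl⟩ <;>
  rcases hs' with ⟨rfl, rfl⟩ | ⟨rfl, rfl⟩ | ⟨rfl, rfl⟩ | ⟨rfl, rfl⟩ <;>
  interval_cases a <;> interval_cases b <;> norm_num [IsUnitStep]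

open SimpleGraph in
theorem ncard_neighborSet_toSubgraph_le_two {V : Type*} {G : SimpleGraph V} {u w : V}
    {p : G.Walk u w} (hp : p.IsPath) (v : V) : (p.toSubgraph.neighborSet v).ncard ≤ 2 := by
  by_cases hv : v ∈ p.support
  · obtain ⟨i, rfl, hi⟩ := Walk.mem_support_iff_exists_getVert.1 hv
    by_cases hnil : p.Nil
    · have : p.toSubgraph.neighborSet (p.getVert i) = ∅ := by
        ext x
        have := Walk.length_eq_zero_iff.2 hnil
        simp only [Subgraph.mem_neighborSet, Walk.toSubgraph_adj_iff]
        simp [this]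
      simp [this]
    rcases eq_or_ne i 0 with rfl | h0
    · simp [hp.neighborSet_toSubgraph_startpoint hnil]
    rcases hi.eq_or_lt with rfl | hlt
    · simp [hp.neighborSet_toSubgraph_endpoint hnil]
    · exact (hp.ncard_neighborSet_toSubgraph_internal_eq_two h0 hlt).le
  · have : p.toSubgraph.neighborSet v = ∅ := by
      ext x
      simp only [Subgraph.mem_neighborSet, Set.mem_empty_iff_false, iff_false]
      exact fun h => hv (p.mem_verts_toSubgraph.1 h.fst_mem)
    simp [this]

open SimpleGraph in
theorem exists_isTree_le_of_isHamiltonian {V : Type*} [Fintype V] [DecidableEq V]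
    {G : SimpleGraph V} {u w : V} {p : G.Walk u w} (hp : p.IsHamiltonian) :
    ∃ H ≤ G, H.IsTree ∧ ∀ v, (H.neighborSet v).ncard ≤ 2 := by
  have hconn : p.toSubgraph.spanningCoe.Connected := by
    have : p.toSubgraph.IsSpanning := fun v => p.mem_verts_toSubgraph.2 (hp.mem_support v)
    have h := p.toSubgraph_connected
    rw [Subgraph.connected_iff'] at h
    exact (p.toSubgraph.spanningCoeEquivCoeOfSpanning this).connected_iff.2 h
  obtain ⟨H, hle, hH⟩ := hconn.exists_isTree_le
  refine ⟨H, hle.trans p.toSubgraph.spanningCoe_le, hH, fun v => ?_⟩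
  exact (Set.ncard_le_ncard (fun x hx => hle hx) (Set.toFinite _)).trans
    (ncard_neighborSet_toSubgraph_le_two hp.isPath v)

open SimpleGraph in
theorem exists_isHamiltonian_of_ncard_neighborSet_le_two {V : Type*} [Fintype V] [DecidableEq V]
    {H : SimpleGraph V} (hH : H.Connected) (hdeg : ∀ v, (H.neighborSet v).ncard ≤ 2) :
    ∃ (u w : V) (p : H.Walk u w), p.IsHamiltonian := by
  have key : ∀ k < Fintype.card V, ∃ (u w : V) (p : H.Walk u w), p.IsPath ∧ p.length = k := by
    intro k
    induction k with
    | zero =>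
      intro _
      obtain ⟨v⟩ := hH.nonempty
      exact ⟨v, v, .nil, .nil, rfl⟩
    | succ k ih =>
      intro hk
      obtain ⟨u, w, p, hp, hlen⟩ := ih (by lia)
      obtain ⟨z, hz⟩ : ∃ z, z ∉ p.support := by
        by_contra! h
        have := (hp.isHamiltonian_of_mem h).length_eq
        lia
      obtain ⟨q⟩ := hH.preconnected u z
      obtain ⟨⟨⟨x, y⟩, hxy⟩, -, hx, hy⟩ :=
        q.exists_boundary_dart {v | v ∈ p.support} p.start_mem_support hz
      replace hx : x ∈ p.support := hx
      replace hy : y ∉ p.support := hy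
      replace hxy : H.Adj x y := hxy
      obtain ⟨i, rfl, hi⟩ := Walk.mem_support_iff_exists_getVert.1 hx
      rcases eq_or_ne i 0 with rfl | h0
      · rw [Walk.getVert_zero] at hxy
        exact ⟨y, w, .cons hxy.symm p, hp.cons hy, by simp [hlen]⟩
      rcases hi.eq_or_lt with rfl | hlt
      · rw [Walk.getVert_length] at hxy
        exact ⟨u, y, p.concat hxy, hp.concat hy hxy, by simp [hlen]⟩
      exfalso
      have h2 := hp.ncard_neighborSet_toSubgraph_internal_eq_two h0 hlt
      have hnot : y ∉ p.toSubgraph.neighborSet (p.getVert i) :=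
        fun h => hy (p.mem_verts_toSubgraph.1 h.snd_mem)
      have h3 := Set.ncard_insert_of_notMem hnot (Set.toFinite _)
      have h4 : (insert y (p.toSubgraph.neighborSet (p.getVert i))).ncard
          ≤ (H.neighborSet (p.getVert i)).ncard :=
        Set.ncard_le_ncard (Set.insert_subset hxy (Subgraph.neighborSet_subset _ _))
          (Set.toFinite _)
      have := hdeg (p.getVert i)
      lia
  have : 0 < Fintype.card V := Fintype.card_pos_iff.2 hH.nonempty
  obtain ⟨u, w, p, hp, hlen⟩ := key (Fintype.card V - 1) (by lia)
  exact ⟨u, w, p, Walk.isHamiltonian_iff_isPath_and_length_eq.2 ⟨hp, hlen⟩⟩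

open scoped Classical in
theorem sum_adj_eq_two_mul_card_edgeSet {W : Type*} [Fintype W] (T : SimpleGraph W) :
    ∑ p : W, ∑ r : W, (if T.Adj p r then (1 : ℝ) else 0) = 2 * Nat.card T.edgeSet := by
  have h := T.sum_degrees_eq_twice_card_edges
  have h' : ∀ p, ∑ r : W, (if T.Adj p r then (1 : ℝ) else 0) = T.degree p := fun p => by
    rw [Finset.sum_boole, ← SimpleGraph.card_neighborFinset_eq_degree,
      SimpleGraph.neighborFinset_eq_filter]
  simp_rw [h']
  rw [Nat.card_eq_fintype_card, ← SimpleGraph.edgeFinset_card]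
  exact_mod_cast h

open scoped Classical in
theorem SimpleGraph.IsTree.sum_adj {W : Type*} [Fintype W] {T : SimpleGraph W} (hT : T.IsTree) :
    ∑ p : W, ∑ r : W, (if T.Adj p r then (1 : ℝ) else 0) = 2 * (Fintype.card W - 1) := by
  rw [sum_adj_eq_two_mul_card_edgeSet, ← Nat.card_eq_fintype_card,
    ← (SimpleGraph.isTree_iff_connected_and_card.1 hT).2]
  push_cast
  ring

/-- The graph `H` with a pendant vertex `inr v` attached to each vertex `v`. -/
def withPendants {V : Type*} (H : SimpleGraph V) : SimpleGraph (V ⊕ V) where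
  Adj
    | .inl u, .inl v => H.Adj u v
    | .inl u, .inr v => u = v
    | .inr u, .inl v => u = v
    | .inr _, .inr _ => False
  symm := ⟨by rintro (u | u) (v | v) h <;> first | exact h.symm | exact h⟩
  loopless := ⟨by rintro (u | u) h <;> first | exact H.loopless.irrefl _ h | exact h⟩

theorem isTree_withPendants {V : Type*} [Fintype V] {H : SimpleGraph V} (hH : H.IsTree) :
    (withPendants H).IsTree := by
  classical
  rw [SimpleGraph.isTree_iff_connected_and_card]
  have hl : ∀ u v, (withPendants H).Reachable (.inl u) (.inl v) := fun u v =>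
    (hH.connected.preconnected u v).map (⟨Sum.inl, fun h => h⟩ : H →g withPendants H)
  have hr : ∀ v, (withPendants H).Reachable (.inl v) (.inr v) := fun v =>
    SimpleGraph.Adj.reachable (show v = v from rfl)
  refine ⟨?_, ?_⟩
  · have := hH.connected.nonempty
    refine ⟨?_⟩
    rintro (u | u) (v | v)
    · exact hl u v
    · exact (hl u v).trans (hr v)
    · exact (hr u).symm.trans (hl u v)
    · exact (hr u).symm.trans ((hl u v).trans (hr v))
  · have h := sum_adj_eq_two_mul_card_edgeSet (withPendants H)
    have hll : ∀ u v, (if (withPendants H).Adj (.inl u) (.inl v) then (1 : ℝ) else 0)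
        = if H.Adj u v then 1 else 0 := fun _ _ => if_congr .rfl rfl rfl
    have hlr : ∀ u v, (if (withPendants H).Adj (.inl u) (.inr v) then (1 : ℝ) else 0)
        = if u = v then 1 else 0 := fun _ _ => if_congr .rfl rfl rfl
    have hrl : ∀ u v, (if (withPendants H).Adj (.inr u) (.inl v) then (1 : ℝ) else 0)
        = if u = v then 1 else 0 := fun _ _ => if_congr .rfl rfl rfl
    have hrr : ∀ u v, (if (withPendants H).Adj (.inr u) (.inr v) then (1 : ℝ) else 0)
        = 0 := fun _ _ => if_neg id
    simp only [Fintype.sum_sum_type, Finset.sum_add_distrib, hll, hlr, hrl, hrr] at h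
    rw [hH.sum_adj] at h
    simp only [Finset.sum_ite_eq, Finset.mem_univ, if_true, Finset.sum_const_zero,
      Finset.sum_const, Finset.card_univ, nsmul_eq_mul, mul_one, add_zero] at h
    rw [Nat.card_eq_fintype_card (α := V ⊕ V), Fintype.card_sum]
    have : ((Nat.card (withPendants H).edgeSet + 1 : ℕ) : ℝ)
        = ((Fintype.card V + Fintype.card V : ℕ) : ℝ) := by
      push_cast
      linarith
    exact_mod_cast this

theorem connected_comap_inl {V : Type*} {T : SimpleGraph (V ⊕ V)} (hT : T.Connected)
    (h : ∀ p r, T.Adj p r → r ≠ p.swap → (∃ u, p = .inl u) ∧ ∃ v, r = .inl v) :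
    (T.comap Sum.inl).Connected := by
  have step : ∀ p r, T.Adj p r →
      (T.comap Sum.inl).Reachable (Sum.elim id id p : V) (Sum.elim id id r) := by
    intro p r hpr
    by_cases hs : r = p.swap
    · subst hs
      rcases p with v | v <;> exact .refl _
    · obtain ⟨⟨u, rfl⟩, ⟨v, rfl⟩⟩ := h p r hpr hs
      exact SimpleGraph.Adj.reachable (G := T.comap Sum.inl) hpr
  have walk : ∀ p r, T.Walk p r →
      (T.comap Sum.inl).Reachable (Sum.elim id id p : V) (Sum.elim id id r) := by
    intro p r w
    induction w with
    | nil => exact .refl _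
    | cons hadj _ ih => exact (step _ _ hadj).trans ih
  obtain ⟨p⟩ := hT.nonempty
  have : Nonempty V := ⟨Sum.elim id id p⟩
  refine ⟨fun u v => ?_⟩
  obtain ⟨w⟩ := hT.preconnected (.inl u) (.inl v)
  exact walk _ _ w

theorem wt_eq_iff_of_isTree {V : Type*} [Fintype V] {T : SimpleGraph (V ⊕ V)} (hT : T.IsTree)
    {P : V ⊕ V → Pl} {c : V → ℝ} (hc : ∀ v, c v < 1)
    (hpair : ∀ v, dist (P (.inl v)) (P (.inr v)) = c v)
    (hfar : ∀ p r, p ≠ r → r ≠ p.swap → 1 ≤ dist (P p) (P r)) :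
    wt T P = Fintype.card V - 1 + ∑ v, c v ↔
      (∀ p, T.Adj p p.swap) ∧ ∀ p r, T.Adj p r → r ≠ p.swap → dist (P p) (P r) = 1 := by
  classical
  have hswap : ∀ p : V ⊕ V, dist (P p) (P p.swap) = Sum.elim c c p := by
    rintro (v | v)
    · exact hpair v
    · exact (dist_comm _ _).trans (hpair v)
  set E : V ⊕ V → V ⊕ V → ℝ := fun p r =>
    ((if T.Adj p r then dist (P p) (P r) else 0) - if T.Adj p r then 1 else 0)
      + if r = p.swap then 1 - Sum.elim c c p else 0 with hE
  have hc' : ∀ p, Sum.elim c c p < 1 := by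
    rintro (v | v) <;> exact hc v
  have hval : ∀ p r, 0 ≤ E p r ∧ (E p r = 0 ↔
      (r = p.swap → T.Adj p r) ∧ (T.Adj p r → r ≠ p.swap → dist (P p) (P r) = 1)) := by
    intro p r
    have := hc' p
    by_cases hs : r = p.swap
    · subst hs
      by_cases ha : T.Adj p p.swap
      · simp [hE, ha, hswap]
      · simp only [hE, ha, if_false, if_true]
        refine ⟨by linarith, ?_⟩
        constructor
        · intro h
          linarith
        · intro h
          exact (h.1 trivial).elim
    · by_cases ha : T.Adj p r
      · have := hfar p r ha.ne hs
        simp [hE, ha, hs, this, sub_eq_zero]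
      · simp [hE, ha, hs]
  have htot : ∑ p, ∑ r, E p r = 2 * wt T P - 2 * (Fintype.card V - 1 + ∑ v, c v) := by
    simp only [hE, Finset.sum_add_distrib, Finset.sum_sub_distrib]
    rw [hT.sum_adj]
    simp only [Finset.sum_ite_eq', Finset.mem_univ, if_true]
    simp only [Finset.sum_sub_distrib, Fintype.sum_sum_type (f := Sum.elim c c), Fintype.card_sum,
      Finset.sum_const, Finset.card_univ, nsmul_eq_mul, Sum.elim_inl, Sum.elim_inr, wt]
    push_cast
    ring
  have hzero : wt T P = Fintype.card V - 1 + ∑ v, c v ↔ ∑ p, ∑ r, E p r = 0 := by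
    rw [htot]
    constructor <;> intro h <;> linarith
  rw [hzero, Finset.sum_eq_zero_iff_of_nonneg
    fun p _ => Finset.sum_nonneg fun r _ => (hval p r).1]
  simp only [Finset.mem_univ, true_imp_iff]
  simp only [Finset.sum_eq_zero_iff_of_nonneg fun r _ => (hval _ r).1, Finset.mem_univ,
    true_imp_iff, (hval _ _).2]
  exact ⟨fun h => ⟨fun p => (h p _).1 rfl, fun p r => (h p r).2⟩,
    fun h p r => ⟨fun hs => hs ▸ h.1 p, h.2 p r⟩⟩

/-- The four unit directions of the square grid. -/
def unitSteps : Finset (ℤ × ℤ) := {(1, 0), (-1, 0), (0, 1), (0, -1)}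

theorem mem_unitSteps {s : ℤ × ℤ} : s ∈ unitSteps ↔ IsUnitStep s.1 s.2 := by
  simp [unitSteps, IsUnitStep, Prod.ext_iff]

theorem card_unitSteps : unitSteps.card = 4 := rfl

theorem exists_unitStep_neg (θ : ℝ) :
    ∃ m ∈ unitSteps, (m.1 : ℝ) * Real.cos θ + m.2 * Real.sin θ < 0 := by
  by_contra! h
  have h1 := h (1, 0) (by simp [unitSteps])
  have h2 := h (-1, 0) (by simp [unitSteps])
  have h3 := h (0, 1) (by simp [unitSteps])
  have h4 := h (0, -1) (by simp [unitSteps])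
  norm_num at h1 h2 h3 h4
  nlinarith [Real.sin_sq_add_cos_sq θ, le_antisymm h2 h1, le_antisymm h4 h3]

theorem exists_forall_unitStep_ne_nonneg {m : ℤ × ℤ} (hm : m ∈ unitSteps) :
    ∃ θ : ℝ, ∀ s ∈ unitSteps, s ≠ m → 0 ≤ (s.1 : ℝ) * Real.cos θ + s.2 * Real.sin θ := by
  simp only [unitSteps, Finset.mem_insert, Finset.mem_singleton] at hm
  rcases hm with rfl | rfl | rfl | rfl
  · exact ⟨π, by simp [unitSteps]⟩
  · exact ⟨0, by simp [unitSteps]⟩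
  · exact ⟨-(π / 2), by simp [unitSteps]⟩
  · exact ⟨π / 2, by simp [unitSteps]⟩

theorem one_lt_dist_pt {a b c d : ℝ} (h : 1 < (a - c) ^ 2 + (b - d) ^ 2) :
    1 < dist (pt a b) (pt c d) := by
  rw [dist_pt]
  exact Real.lt_sqrt_of_sq_lt (by simpa using h)

/-- A closed half-plane through the origin containing the unit steps in `S` and one further unit
step `d` exists only if `S` has at most two elements. -/
theorem card_le_two_of_forall_nonneg {S : Finset (ℤ × ℤ)} (hS : S ⊆ unitSteps) {d : ℤ × ℤ}
    (hd : d ∈ unitSteps) (hdS : d ∉ S) {θ : ℝ}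
    (h : ∀ s ∈ insert d S, 0 ≤ (s.1 : ℝ) * Real.cos θ + s.2 * Real.sin θ) : S.card ≤ 2 := by
  obtain ⟨m, hm, hneg⟩ := exists_unitStep_neg θ
  have hm' : m ∉ insert d S := fun hmem => (h m hmem).not_gt hneg
  have hle := Finset.card_le_card
    (Finset.insert_subset hm (Finset.insert_subset hd hS))
  rw [Finset.card_insert_of_notMem hm', Finset.card_insert_of_notMem hdS, card_unitSteps] at hle
  lia

theorem exists_forall_nonneg_of_card_le_two {S : Finset (ℤ × ℤ)} (hS : S.card ≤ 2)
    (hSu : S ⊆ unitSteps) {d : ℤ × ℤ} (hd : d ∈ unitSteps) :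
    ∃ θ : ℝ, ∀ s ∈ insert d S, 0 ≤ (s.1 : ℝ) * Real.cos θ + s.2 * Real.sin θ := by
  obtain ⟨m, hm, hmS⟩ : ∃ m ∈ unitSteps, m ∉ insert d S := by
    by_contra! h
    have h1 := Finset.card_le_card (show unitSteps ⊆ insert d S from h)
    have h2 := Finset.card_insert_le d S
    rw [card_unitSteps] at h1
    lia
  obtain ⟨θ, hθ⟩ := exists_forall_unitStep_ne_nonneg hm
  exact ⟨θ, fun s hs => hθ s (Finset.insert_subset hd hSu hs) fun e => hmS (e ▸ hs)⟩

theorem exists_inner_nonpos (d : ℤ × ℤ) :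
    ∃ θ : ℝ, (d.1 : ℝ) * Real.cos θ + d.2 * Real.sin θ ≤ 0 := by
  rcases le_total d.1 0 with h | h
  · exact ⟨0, by simpa using h⟩
  · exact ⟨π, by simpa using h⟩

/-- NP-hardness gadget for α = π.  Let `G` be a square grid graph of maximum
degree at most 3 with a proper 2-coloring having `n₁` black and `n₂` white
vertices.  Augment the vertex set with one point `q v` per vertex `v`, placed on
a missing incident grid edge at distance 1/4 (black) or 1/5 (white) from `v`.
Then `G` has a Hamiltonian path iff the augmented point set has a spanning tree
of weight `n − 1 + n₁/4 + n₂/5` whose angular span at every point is at most π. -/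
theorem stmt9 (V : Type*) [Fintype V] [DecidableEq V]
    (pos : V → Pl) (hint : ∀ v : V, ∃ i j : ℤ, pos v = pt (i : ℝ) (j : ℝ))
    (hinj : Function.Injective pos)
    (G : SimpleGraph V) [DecidableRel G.Adj]
    (hadj : ∀ u v : V, G.Adj u v ↔ u ≠ v ∧ dist (pos u) (pos v) = 1)
    (hdeg : ∀ v : V, G.degree v ≤ 3)
    (col : V → Bool) (hcol : ∀ u v : V, G.Adj u v → col u ≠ col v)
    (n₁ n₂ : ℕ)
    (hn₁ : n₁ = (Finset.univ.filter fun v : V => col v = true).card)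
    (hn₂ : n₂ = (Finset.univ.filter fun v : V => col v = false).card)
    (q : V → Pl)
    (hq : ∀ v : V, ∃ d : Pl,
      (d = pt 1 0 ∨ d = pt (-1) 0 ∨ d = pt 0 1 ∨ d = pt 0 (-1)) ∧
      (∀ u : V, pos u ≠ pos v + d) ∧
      q v = pos v + (if col v = true then (1 / 4 : ℝ) else 1 / 5) • d)
    (P : V ⊕ V → Pl)
    (hP₁ : ∀ v : V, P (Sum.inl v) = pos v) (hP₂ : ∀ v : V, P (Sum.inr v) = q v) :
    (∃ (u w : V) (p : G.Walk u w), p.IsHamiltonian) ↔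
    (∃ T : SimpleGraph (V ⊕ V), T.IsTree ∧
      wt T P = (Fintype.card V : ℝ) - 1 + n₁ / 4 + n₂ / 5 ∧
      ∀ p : V ⊕ V, ∃ θ : ℝ, ∀ r : V ⊕ V, T.Adj p r → P r ∈ wedge (P p) θ π) := by
  classical
  choose X Y hXY using hint
  set c : V → ℝ := fun v => if col v = true then (1 / 4 : ℝ) else 1 / 5 with hcdef
  have hc : ∀ v, c v = 1 / 4 ∨ c v = 1 / 5 := fun v => by
    by_cases h : col v = true <;> simp [hcdef, h]
  have hc0 : ∀ v, 0 < c v := fun v => by rcases hc v with h | h <;> rw [h] <;> norm_num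
  have hc1 : ∀ v, c v ≤ 1 / 4 := fun v => by rcases hc v with h | h <;> norm_num [h]
  have hcsum : (Fintype.card V : ℝ) - 1 + n₁ / 4 + n₂ / 5 = Fintype.card V - 1 + ∑ v, c v := by
    have hfalse : (Finset.univ.filter fun v : V => ¬ col v = true)
        = Finset.univ.filter fun v : V => col v = false := by simp
    rw [hcdef, Finset.sum_ite, Finset.sum_const, Finset.sum_const, hfalse, ← hn₁, ← hn₂]
    simp only [nsmul_eq_mul]
    ring
  set off : V → V → ℤ × ℤ := fun v u => (X u - X v, Y u - Y v) with hoff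
  have hoff_inj : ∀ v, Function.Injective (off v) := fun v a b h => by
    simp only [hoff, Prod.mk.injEq, sub_left_inj] at h
    exact hinj (by rw [hXY, hXY, h.1, h.2])
  have hoff0 : ∀ u v, u ≠ v → ¬(X u - X v = 0 ∧ Y u - Y v = 0) := fun u v huv h =>
    huv (hoff_inj v (by simp [hoff, h.1, h.2]))
  have hdist : ∀ u v, dist (pos u) (pos v) = 1 ↔ off v u ∈ unitSteps := fun u v => by
    rw [mem_unitSteps, isUnitStep_iff, hXY, hXY, dist_pt, Real.sqrt_eq_one]
    exact_mod_cast Iff.rfl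
  have hGadj : ∀ u v, G.Adj u v ↔ off v u ∈ unitSteps := fun u v => by
    rw [hadj, hdist, and_iff_right_of_imp]
    rintro h rfl
    simp [hoff, unitSteps] at h
  have hq' : ∀ v, ∃ d ∈ unitSteps, (∀ u, off v u ≠ d) ∧
      q v = pt (X v + c v * d.1) (Y v + c v * d.2) := by
    intro v
    obtain ⟨d, hd, hfree, hqv⟩ := hq v
    obtain ⟨s, hs, rfl⟩ : ∃ s ∈ unitSteps, d = pt (s.1 : ℝ) s.2 := by
      rcases hd with rfl | rfl | rfl | rfl
      · exact ⟨(1, 0), by simp [unitSteps], by simp⟩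
      · exact ⟨(-1, 0), by simp [unitSteps], by simp⟩
      · exact ⟨(0, 1), by simp [unitSteps], by simp⟩
      · exact ⟨(0, -1), by simp [unitSteps], by simp⟩
    refine ⟨s, hs, fun u hu => hfree u ?_, by rw [hqv, hXY, pt_add_smul]⟩
    have := pt_add_smul (X v) (Y v) 1 s.1 s.2
    rw [one_smul] at this
    rw [hXY, hXY v, this, ← hu, pt_inj]
    simp [hoff]
  choose d hd hdfree hqd using hq'
  have hd' : ∀ v, IsUnitStep (d v).1 (d v).2 := fun v => mem_unitSteps.1 (hd v)
  have hdfree' : ∀ u v, ¬(X u - X v = (d v).1 ∧ Y u - Y v = (d v).2) := fun u v h =>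
    hdfree v u (Prod.ext h.1 h.2)
  have hpair : ∀ v, dist (P (.inl v)) (P (.inr v)) = c v := fun v => by
    have hu : ((d v).1 : ℝ) ^ 2 + ((d v).2 : ℝ) ^ 2 = 1 := by
      exact_mod_cast (isUnitStep_iff _ _).1 (hd' v)
    rw [hP₁, hP₂, hXY, hqd, dist_pt, Real.sqrt_eq_iff_eq_sq (by positivity) (hc0 v).le]
    linear_combination c v ^ 2 * hu
  have hpp : ∀ u v, u ≠ v → 1 ≤ dist (pos u) (pos v) := fun u v huv => by
    rw [hXY, hXY, dist_pt, Real.one_le_sqrt]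
    have : 1 ≤ (X u - X v) ^ 2 + (Y u - Y v) ^ 2 := by
      by_contra hlt
      exact hoff0 u v huv ⟨by nlinarith, by nlinarith⟩
    exact_mod_cast this
  have hpq : ∀ u v, u ≠ v → 1 < dist (pos u) (q v) := fun u v huv => by
    rw [hXY, hqd]
    have := one_lt_sq_add_sq_of_step (hd' v) (hc0 v) (hc1 v) (hoff0 u v huv) (hdfree' u v)
    push_cast at this
    exact one_lt_dist_pt (by convert this using 2 <;> ring)
  have hqq : ∀ u v, u ≠ v → 1 < dist (q u) (q v) := fun u v huv => by
    rw [hqd, hqd]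
    have := one_lt_sq_add_sq_of_two_steps (hd' v) (hd' u) (hc v) (hc u) (hoff0 u v huv)
      (hdfree' u v) (fun h => hdfree' v u ⟨by lia, by lia⟩) fun hs => by
        have hne := hcol u v ((hGadj u v).2 (mem_unitSteps.2 hs))
        simp only [hcdef]
        cases hu : col u <;> cases hv : col v <;> simp_all
    push_cast at this
    exact one_lt_dist_pt (by convert this using 2 <;> ring)
  have hfar : ∀ p r : V ⊕ V, p ≠ r → r ≠ p.swap → 1 ≤ dist (P p) (P r) := by
    rintro (u | u) (v | v) hne hsw <;> simp only [hP₁, hP₂]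
    · exact hpp u v fun e => hne (e ▸ rfl)
    · exact (hpq u v fun e => hsw (e ▸ rfl)).le
    · exact dist_comm (pos v) (q u) ▸ (hpq v u fun e => hsw (e ▸ rfl)).le
    · exact (hqq u v fun e => hne (e ▸ rfl)).le
  have hwt : ∀ {T : SimpleGraph (V ⊕ V)}, T.IsTree → _ := fun hT =>
    wt_eq_iff_of_isTree hT (P := P) (c := c) (fun v => by linarith [hc1 v]) hpair hfar
  have hwedge_pos : ∀ u v θ, P (.inl u) ∈ wedge (P (.inl v)) θ π ↔
      0 ≤ ((off v u).1 : ℝ) * Real.cos θ + (off v u).2 * Real.sin θ := fun u v θ => by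
    rw [mem_wedge_pi_iff, hP₁, hP₁, hXY, hXY]
    simp [pt, hoff]
  have hwedge_pendant : ∀ v θ, P (.inr v) ∈ wedge (P (.inl v)) θ π ↔
      0 ≤ ((d v).1 : ℝ) * Real.cos θ + (d v).2 * Real.sin θ := fun v θ => by
    rw [mem_wedge_pi_iff, hP₁, hP₂, hXY, hqd, ← mul_nonneg_iff_of_pos_left (hc0 v)
      (b := (d v).1 * Real.cos θ + (d v).2 * Real.sin θ)]
    simp [pt, mul_add, mul_assoc]
  have hwedge_pendant' : ∀ v θ, P (.inl v) ∈ wedge (P (.inr v)) θ π ↔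
      ((d v).1 : ℝ) * Real.cos θ + (d v).2 * Real.sin θ ≤ 0 := fun v θ => by
    rw [mem_wedge_pi_iff, hP₁, hP₂, hXY, hqd, ← neg_nonneg, ← mul_nonneg_iff_of_pos_left (hc0 v)
      (b := -((d v).1 * Real.cos θ + (d v).2 * Real.sin θ))]
    simp [pt, mul_add, mul_assoc, add_comm]
  rw [hcsum]
  constructor
  · rintro ⟨u, w, p, hp⟩
    obtain ⟨H, hHG, hH, hHdeg⟩ := exists_isTree_le_of_isHamiltonian hp
    have hT := isTree_withPendants hH
    refine ⟨withPendants H, hT, (hwt hT).2 ⟨?_, ?_⟩, ?_⟩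
    · rintro (v | v) <;> exact rfl
    · rintro (a | a) (b | b) hab hsw
      · rw [hP₁, hP₁]
        exact ((hadj a b).1 (hHG hab)).2
      · exact absurd (congrArg Sum.inr (Eq.symm hab)) hsw
      · exact absurd (congrArg Sum.inl (Eq.symm hab)) hsw
      · exact hab.elim
    · rintro (v | v)
      · obtain ⟨θ, hθ⟩ := exists_forall_nonneg_of_card_le_two
          (S := (H.neighborFinset v).image (off v)) (d := d v)
          (Finset.card_image_le.trans (by
            rw [SimpleGraph.neighborFinset, ← Set.ncard_eq_toFinset_card']
            exact hHdeg v))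
          (fun s hs => by
            obtain ⟨x, hx, rfl⟩ := Finset.mem_image.1 hs
            exact (hGadj x v).1 (hHG ((H.mem_neighborFinset v x).1 hx)).symm)
          (hd v)
        refine ⟨θ, ?_⟩
        rintro (x | x) hx
        · exact (hwedge_pos x v θ).2 (hθ _ (Finset.mem_insert_of_mem
            (Finset.mem_image_of_mem _ ((H.mem_neighborFinset v x).2 hx))))
        · obtain rfl : v = x := hx
          exact (hwedge_pendant v θ).2 (hθ _ (Finset.mem_insert_self _ _))
      · obtain ⟨θ, hθ⟩ := exists_inner_nonpos (d v)
        refine ⟨θ, ?_⟩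
        rintro (x | x) hx
        · obtain rfl : v = x := hx
          exact (hwedge_pendant' v θ).2 hθ
        · exact hx.elim
  · rintro ⟨T, hT, hTwt, hTspan⟩
    obtain ⟨hTpair, hTunit⟩ := (hwt hT).1 hTwt
    have hTinl : ∀ p r, T.Adj p r → r ≠ p.swap → (∃ u, p = .inl u) ∧ ∃ v, r = .inl v := by
      intro p r hpr hsw
      have h1 := hTunit p r hpr hsw
      have hne := hpr.ne
      rcases p with u | u <;> rcases r with v | v
      · exact ⟨⟨u, rfl⟩, ⟨v, rfl⟩⟩
      all_goals
        simp only [hP₁, hP₂] at h1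
      · exact absurd h1 (hpq u v fun e => hsw (e ▸ rfl)).ne'
      · rw [dist_comm] at h1
        exact absurd h1 (hpq v u fun e => hsw (e ▸ rfl)).ne'
      · exact absurd h1 (hqq u v fun e => hne (e ▸ rfl)).ne'
    have hstep : ∀ u v, (T.comap Sum.inl).Adj v u → off v u ∈ unitSteps := fun u v huv => by
      have := hTunit _ _ (T.adj_symm huv) (by simp)
      rwa [hP₁, hP₁, hdist] at this
    have hle : T.comap Sum.inl ≤ G := fun u v huv => (hGadj u v).2 (hstep u v huv.symm)
    obtain ⟨u, w, p, hp⟩ := exists_isHamiltonian_of_ncard_neighborSet_le_two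
      (connected_comap_inl hT.connected hTinl) fun v => by
        obtain ⟨θ, hθ⟩ := hTspan (.inl v)
        rw [Set.ncard_eq_toFinset_card', ← Finset.card_image_of_injective _ (hoff_inj v)]
        refine card_le_two_of_forall_nonneg (d := d v) (θ := θ) ?_ (hd v) ?_ ?_
        · intro s hs
          obtain ⟨x, hx, rfl⟩ := Finset.mem_image.1 hs
          rw [Set.mem_toFinset] at hx
          exact hstep x v hx
        · intro hs
          obtain ⟨x, -, hx⟩ := Finset.mem_image.1 hs
          exact hdfree v x hx
        · intro s hs
          rcases Finset.mem_insert.1 hs with rfl | hs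
          · exact (hwedge_pendant v θ).1 (hθ _ (hTpair (.inl v)))
          · obtain ⟨x, hx, rfl⟩ := Finset.mem_image.1 hs
            rw [Set.mem_toFinset] at hx
            exact (hwedge_pos x v θ).1 (hθ _ hx)
    exact ⟨u, w, p.map (.ofLE hle), hp.map (f := .ofLE hle) Function.bijective_id⟩
end

section
/- Main connectivity theorem: Let S₁ = {a, b, c} and S₂ = {x, y, z} be two triplets of points in the plane (all six points distinct), and suppose the wedges of angle 2π/3 of S₁ and, independently, of S₂ are oriented according to the gadget construction (for a triplet with sorted angles ∠b ≤ ∠c ≤ ∠a, drawn with bc horizontal, b left of c, a above the line bc, set bisector orientations 240°, 0°, 120° at a, b, c respectively, then rotate/translate back). Then the induced mutual-coverage graph on S₁ ∪ S₂ is connected. -/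
open Real

open EuclideanGeometry in
/-- The gadget orientation of Claim 1: the triplet `a b c` is labelled so that
the triangle angles satisfy `∠b ≤ ∠c ≤ ∠a`; in a frame rotated by `φ` the
segment `bc` is horizontal with `b` left of `c` and `a` on or above the line
through `bc`; the bisector orientations of the 2π/3-wedges at `a`, `b`, `c` are
240°, 0°, 120° in that frame. -/
def gadget (a b c : Pl) (θa θb θc : ℝ) : Prop :=
  AffineIndependent ℝ ![a, b, c] ∧
  ∠ a b c ≤ ∠ b c a ∧ ∠ b c a ≤ ∠ c a b ∧
  ∃ φ : ℝ, c - b = ‖c - b‖ • dir φ ∧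
    0 ≤ (a - b) 0 * dir (φ + π / 2) 0 + (a - b) 1 * dir (φ + π / 2) 1 ∧
    θb = φ ∧ θc = φ + 2 * π / 3 ∧ θa = φ + 4 * π / 3

/-- The cross product of `dir θ` with `v`: nonnegative iff `v` is to the left of direction `θ`. -/
noncomputable def cross (θ : ℝ) (v : Pl) : ℝ := cos θ * v 1 - sin θ * v 0

theorem dir_zero (θ : ℝ) : dir θ 0 = cos θ := by simp [dir, pt]

theorem dir_one (θ : ℝ) : dir θ 1 = sin θ := by simp [dir, pt]

theorem dir_add_two_pi (θ : ℝ) : dir (θ + 2 * π) = dir θ := by simp [dir]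

theorem cross_add_pi (θ : ℝ) (v : Pl) : cross (θ + π) v = -cross θ v := by
  simp [cross]; ring

theorem cross_add_two_pi (θ : ℝ) (v : Pl) : cross (θ + 2 * π) v = cross θ v := by
  simp [cross]

theorem cross_add_third (θ : ℝ) (v : Pl) :
    cross θ v + cross (θ + 2 * π / 3) v + cross (θ + 4 * π / 3) v = 0 := by
  have h2 : θ + 2 * π / 3 = θ + π - π / 3 := by ring
  have h4 : θ + 4 * π / 3 = θ + π + π / 3 := by ring
  rw [h2, h4]
  simp only [cross, cos_add, cos_sub, sin_add, sin_sub, cos_pi, sin_pi, cos_pi_div_three,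
    sin_pi_div_three]
  ring

/-- Linear dependence between three directions. -/
theorem sin_mul_cross (r γ δ : ℝ) (v : Pl) :
    sin γ * cross (r + δ) v = sin δ * cross (r + γ) v + sin (γ - δ) * cross r v := by
  simp only [cross, cos_add, sin_add, sin_sub]
  ring

theorem inner_dir (v : Pl) (θ : ℝ) : inner ℝ v (dir θ) = cos θ * v 0 + sin θ * v 1 := by
  simp [PiLp.inner_apply, dir_zero, dir_one, Fin.sum_univ_two]

theorem norm_sq_eq (v : Pl) : ‖v‖ ^ 2 = v 0 ^ 2 + v 1 ^ 2 := by
  simp [EuclideanSpace.norm_sq_eq, Fin.sum_univ_two]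

theorem mem_wedge_of_cross {p q : Pl} {θ r : ℝ} (hθ : dir θ = dir (r + π / 3))
    (h₁ : cross r p ≤ cross r q) (h₂ : cross (r + 2 * π / 3) q ≤ cross (r + 2 * π / 3) p) :
    q ∈ wedge p θ (2 * π / 3) := by
  by_cases hqp : q = p
  · exact Or.inl hqp
  right
  set v := q - p with hv
  have hv0 : 0 < ‖v‖ := norm_pos_iff.2 (sub_ne_zero.2 hqp)
  set s := r + π / 3 with hs
  have hr : r = s - π / 3 := by rw [hs]; ring
  have hr' : r + 2 * π / 3 = s + π / 3 := by rw [hs]; ring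
  set X := cos s * v 0 + sin s * v 1 with hX
  set Y := cos s * v 1 - sin s * v 0 with hY
  have e₁ : 0 ≤ Y + √3 * X := by
    rw [hr] at h₁
    simp only [cross, cos_sub, sin_sub, cos_pi_div_three, sin_pi_div_three] at h₁
    simp only [hX, hY, hv, PiLp.sub_apply]
    linarith
  have e₂ : Y ≤ √3 * X := by
    rw [hr'] at h₂
    simp only [cross, cos_add, sin_add, cos_pi_div_three, sin_pi_div_three] at h₂
    simp only [hX, hY, hv, PiLp.sub_apply]
    linarith
  have hs3 : √3 ^ 2 = 3 := sq_sqrt (by norm_num)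
  have hs3' : 0 < √3 := by positivity
  have hX0 : 0 ≤ X := by
    by_contra! hneg
    nlinarith
  have hn : ‖v‖ ^ 2 = X ^ 2 + Y ^ 2 := by
    rw [norm_sq_eq, hX, hY]
    linear_combination (-(v 0 ^ 2 + v 1 ^ 2)) * (sin_sq_add_cos_sq s)
  have hle : ‖v‖ ≤ 2 * X := by
    refine (sq_le_sq₀ hv0.le (by linarith)).1 ?_
    nlinarith
  have hd : ‖dir s‖ = 1 := by
    have : ‖dir s‖ ^ 2 = 1 := by rw [norm_sq_eq, dir_zero, dir_one, cos_sq_add_sin_sq]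
    nlinarith [norm_nonneg (dir s)]
  have hπ : 2 * π / 3 / 2 = arccos (1 / 2) := by
    rw [← cos_pi_div_three, arccos_cos (by positivity) (by linarith [pi_pos])]
    ring
  rw [hθ, InnerProductGeometry.angle, inner_dir, hd, hπ]
  apply arccos_le_arccos
  rw [mul_one, le_div_iff₀ hv0]
  linarith

/-- Two points see each other when the displacement lies in a common sector of their wedges. -/
theorem mutual_of_cross {p q : Pl} {θp θq r γ : ℝ} (hγ : 0 < γ) (hγ' : γ ≤ 2 * π / 3)
    (hp : dir θp = dir (r + π / 3)) (hq : dir θq = dir (r + γ + 2 * π / 3))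
    (h₁ : cross r p ≤ cross r q) (h₂ : cross (r + γ) q ≤ cross (r + γ) p) :
    q ∈ wedge p θp (2 * π / 3) ∧ p ∈ wedge q θq (2 * π / 3) := by
  have hπ := pi_pos
  have hs : 0 < sin γ := sin_pos_of_pos_of_lt_pi hγ (by linarith)
  have hs' : 0 ≤ sin (2 * π / 3 - γ) :=
    sin_nonneg_of_nonneg_of_le_pi (by linarith) (by linarith)
  have hs'' : 0 ≤ sin (2 * π / 3) := sin_nonneg_of_nonneg_of_le_pi (by linarith) (by linarith)
  constructor
  · refine mem_wedge_of_cross hp h₁ ?_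
    have ep := sin_mul_cross r γ (2 * π / 3) p
    have eq := sin_mul_cross r γ (2 * π / 3) q
    rw [← neg_sub, sin_neg] at ep eq
    refine le_of_mul_le_mul_left ?_ hs
    nlinarith
  · have hr : r + γ + π / 3 = r + (γ - 2 * π / 3) + π := by ring
    refine mem_wedge_of_cross (r := r + γ + π / 3) (by rw [hq]; congr 1; ring) ?_ ?_
    · rw [hr, cross_add_pi, cross_add_pi, neg_le_neg_iff]
      have ep := sin_mul_cross r γ (γ - 2 * π / 3) p
      have eq := sin_mul_cross r γ (γ - 2 * π / 3) q
      rw [sub_sub_cancel, ← neg_sub, sin_neg] at ep eq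
      refine le_of_mul_le_mul_left ?_ hs
      rw [neg_sub] at ep eq
      nlinarith
    · have hr' : r + γ + π / 3 + 2 * π / 3 = r + γ + π := by ring
      rw [hr', cross_add_pi, cross_add_pi]
      linarith

/-- Three apexes whose wedges point in the directions `r + π / 3 + 2kπ / 3`, with consecutive wedges
overlapping along their common boundary directions, and with the support sums of a triangle with
vertices `(0, 0)`, `(L, 0)` and `(u, v)`. -/
structure Spread (θ : Pl → ℝ) (p₀ p₁ p₂ : Pl) (r : ℝ) : Prop where
  dir₀ : dir (θ p₀) = dir (r + π / 3)
  dir₁ : dir (θ p₁) = dir (r + 2 * π / 3 + π / 3)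
  dir₂ : dir (θ p₂) = dir (r + 4 * π / 3 + π / 3)
  cover₀ : cross r p₀ ≤ cross r p₂
  cover₁ : cross (r + 2 * π / 3) p₁ ≤ cross (r + 2 * π / 3) p₀
  cover₂ : cross (r + 4 * π / 3) p₂ ≤ cross (r + 4 * π / 3) p₁
  shape : ∃ L u v : ℝ, 0 < L ∧ 0 ≤ v ∧ L ≤ 2 * u ∧ u ≤ L ∧ ∀ ψ : ℝ,
    cross (r + ψ) p₀ + cross (r + ψ + 2 * π / 3) p₁ + cross (r + ψ + 4 * π / 3) p₂ =
      -L * sin (π / 3 + ψ) + u * sin ψ - v * cos ψ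

namespace Spread

variable {θ : Pl → ℝ} {p₀ p₁ p₂ q₀ q₁ q₂ : Pl} {r β : ℝ}

theorem congr_two_pi {r' : ℝ} (h : Spread θ p₀ p₁ p₂ r) (hr : r = r' + 2 * π) :
    Spread θ p₀ p₁ p₂ r' := by
  subst hr
  have e : ∀ s, r' + 2 * π + s = r' + s + 2 * π := fun s => by ring
  have e' : ∀ s s', r' + s + 2 * π + s' = r' + s + s' + 2 * π := fun s s' => by ring
  obtain ⟨d₀, d₁, d₂, c₀, c₁, c₂, L, u, v, hL, hv, hu, hu', hs⟩ := h
  simp only [e, e', dir_add_two_pi, cross_add_two_pi] at d₀ d₁ d₂ c₀ c₁ c₂ hs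
  exact ⟨d₀, d₁, d₂, c₀, c₁, c₂, L, u, v, hL, hv, hu, hu', hs⟩

theorem rotate (h : Spread θ p₀ p₁ p₂ r) : Spread θ p₁ p₂ p₀ (r + 2 * π / 3) := by
  have e₂ : r + 2 * π / 3 + 2 * π / 3 = r + 4 * π / 3 := by ring
  have e₄ : r + 2 * π / 3 + 4 * π / 3 = r + 2 * π := by ring
  obtain ⟨d₀, d₁, d₂, c₀, c₁, c₂, L, u, v, hL, hv, hu, hu', hs⟩ := h
  refine ⟨d₁, by rw [e₂, d₂], ?_, c₁, by rwa [e₂], ?_, L, u, v, hL, hv, hu, hu', fun ψ => ?_⟩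
  · rw [e₄, d₀, add_right_comm, dir_add_two_pi]
  · rwa [e₄, cross_add_two_pi, cross_add_two_pi]
  · rw [← hs ψ, add_right_comm r (2 * π / 3) ψ,
      show r + ψ + 2 * π / 3 + 2 * π / 3 = r + ψ + 4 * π / 3 by ring,
      show r + ψ + 2 * π / 3 + 4 * π / 3 = r + ψ + 2 * π by ring, cross_add_two_pi]
    ring

theorem exists_rotate (h : Spread θ p₀ p₁ p₂ r) (n : ℤ) :
    ∃ q₀ q₁ q₂, ({q₀, q₁, q₂} : Set Pl) = {p₀, p₁, p₂} ∧
      Spread θ q₀ q₁ q₂ (r + n * (2 * π / 3)) := by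
  induction n using Int.induction_on with
  | zero => exact ⟨p₀, p₁, p₂, rfl, by simpa using h⟩
  | succ n ih =>
    obtain ⟨q₀, q₁, q₂, hset, hq⟩ := ih
    refine ⟨q₁, q₂, q₀, ?_, ?_⟩
    · rw [← hset]; ext; simp; tauto
    · convert hq.rotate using 1
      push_cast; ring
  | pred n ih =>
    obtain ⟨q₀, q₁, q₂, hset, hq⟩ := ih
    refine ⟨q₂, q₀, q₁, ?_, ?_⟩
    · rw [← hset]; ext; simp; tauto
    · refine hq.rotate.rotate.congr_two_pi ?_
      push_cast; ring

/-- The support sums of two triangles cannot satisfy the inequalities forced by the absence of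
mutually visible pairs of the first kind. -/
theorem not_both_pos {L u v L' u' v' : ℝ} (hβ : 0 ≤ β) (hβ' : β ≤ 2 * π / 3)
    (hL : 0 < L) (hv : 0 ≤ v) (hu : u ≤ L) (hL' : 0 < L') (hv' : 0 ≤ v') (hu' : u' ≤ L')
    (h : 0 < -L * sin (π / 3 + β) + u * sin β - v * cos β)
    (h' : 0 < -L' * sin (π / 3 + (2 * π / 3 - β)) + u' * sin (2 * π / 3 - β)
      - v' * cos (2 * π / 3 - β)) : False := by
  have key : ∀ {L u v β : ℝ}, 0 ≤ β → β ≤ π / 3 → 0 < L → 0 ≤ v → u ≤ L →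
      -L * sin (π / 3 + β) + u * sin β - v * cos β ≤ 0 := by
    intro L u v β hβ hβ' hL hv hu
    have hπ := pi_pos
    have hs : 0 ≤ sin β := sin_nonneg_of_nonneg_of_le_pi hβ (by linarith)
    have hc : 0 ≤ cos β := cos_nonneg_of_neg_pi_div_two_le_of_le (by linarith) (by linarith)
    have hss : sin β ≤ sin (π / 3 + β) := by
      have : sin (π / 3 + β) - sin β = cos (β + π / 6) := by
        simp only [sin_add, cos_add, sin_pi_div_three, cos_pi_div_three, sin_pi_div_six,
          cos_pi_div_six]
        ring
      have : 0 ≤ cos (β + π / 6) :=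
        cos_nonneg_of_neg_pi_div_two_le_of_le (by linarith) (by linarith)
      linarith
    nlinarith [mul_nonneg hv hc, mul_le_mul_of_nonneg_right hu hs,
      mul_le_mul_of_nonneg_left hss hL.le]
  rcases le_total β (π / 3) with hle | hle
  · exact absurd (key hβ hle hL hv hu) (not_le.2 h)
  · exact absurd (key (by linarith) (by linarith) hL' hv' hu') (not_le.2 h')

/-- The support sums of two triangles cannot satisfy the inequalities forced by the absence of
mutually visible pairs of the second kind. -/
theorem not_both_lt {L u v L' u' v' : ℝ} (hβ : 0 ≤ β) (hβ' : β ≤ 2 * π / 3)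
    (hL : 0 < L) (hv : 0 ≤ v) (hu : L ≤ 2 * u) (hL' : 0 < L') (hv' : 0 ≤ v') (hu' : L' ≤ 2 * u')
    (h : -L * sin (π / 3 + β) + u * sin β - v * cos β <
      -(-L' * sin (π / 3 + 2 * π / 3) + u' * sin (2 * π / 3) - v' * cos (2 * π / 3)))
    (h' : -L' * sin (π / 3 + (2 * π / 3 - β)) + u' * sin (2 * π / 3 - β)
        - v' * cos (2 * π / 3 - β) <
      -(-L * sin (π / 3 + 2 * π / 3) + u * sin (2 * π / 3) - v * cos (2 * π / 3))) : False := by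
  have hs₁ : sin (π / 3 + 2 * π / 3) = 0 := by
    rw [show π / 3 + 2 * π / 3 = π by ring, sin_pi]
  have hs₂ : sin (2 * π / 3) = √3 / 2 := by
    rw [show 2 * π / 3 = π - π / 3 by ring, sin_pi_sub, sin_pi_div_three]
  have hc₂ : cos (2 * π / 3) = -(1 / 2) := by
    rw [show 2 * π / 3 = π - π / 3 by ring, cos_pi_sub, cos_pi_div_three]
  have key : ∀ {L u v β : ℝ}, 0 ≤ β → β ≤ 2 * π / 3 → L ≤ 2 * u →
      -(2 * cos β * (u * (√3 / 2) + v / 2)) ≤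
        -L * sin (π / 3 + β) + u * sin β - v * cos β := by
    intro L u v β hβ hβ' hu
    have hs : 0 ≤ sin (π / 3 + β) :=
      sin_nonneg_of_nonneg_of_le_pi (by linarith [pi_pos]) (by linarith)
    have := mul_le_mul_of_nonneg_right hu hs
    have e : sin (π / 3 + β) = √3 / 2 * cos β + sin β / 2 := by
      rw [sin_add, sin_pi_div_three, cos_pi_div_three]; ring
    rw [e] at this ⊢
    linarith
  have k := key (v := v) hβ hβ' hu
  have k' := key (v := v') (β := 2 * π / 3 - β) (by linarith) (by linarith) hu'
  rw [hs₁, hs₂, hc₂] at h h'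
  have hs3 : 0 < √3 := by positivity
  set M := u * (√3 / 2) + v / 2 with hM
  set M' := u' * (√3 / 2) + v' / 2 with hM'
  have M0 : 0 < M := by
    have : 0 < u := by linarith
    positivity
  have M0' : 0 < M' := by
    have : 0 < u' := by linarith
    positivity
  have i : M' < 2 * cos β * M := by linarith
  have i' : M < 2 * cos (2 * π / 3 - β) * M' := by linarith
  have c0 : 0 < cos β := by
    by_contra! hc
    nlinarith
  have prod : 4 * (cos β * cos (2 * π / 3 - β)) ≤ 1 := by
    have : 2 * (cos β * cos (2 * π / 3 - β)) =
        cos (2 * π / 3) + cos (2 * π / 3 - 2 * β) := by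
      have e₁ := cos_add β (2 * π / 3 - β)
      have e₂ := cos_sub (2 * π / 3 - β) β
      rw [show β + (2 * π / 3 - β) = 2 * π / 3 by ring] at e₁
      rw [show 2 * π / 3 - β - β = 2 * π / 3 - 2 * β by ring] at e₂
      linarith
    rw [hc₂] at this
    linarith [cos_le_one (2 * π / 3 - 2 * β)]
  have : M * M' < 4 * (cos β * cos (2 * π / 3 - β)) * (M * M') := by
    calc M * M' < (2 * cos (2 * π / 3 - β) * M') * (2 * cos β * M) :=
          mul_lt_mul'' i' i M0.le M0'.le
      _ = _ := by ring
  nlinarith [mul_pos M0 M0']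

theorem exists_mutual (hp : Spread θ p₀ p₁ p₂ r) (hq : Spread θ q₀ q₁ q₂ (r + β + π))
    (hβ : 0 ≤ β) (hβ' : β < 2 * π / 3) :
    ∃ p ∈ ({p₀, p₁, p₂} : Set Pl), ∃ q ∈ ({q₀, q₁, q₂} : Set Pl),
      q ∈ wedge p (θ p) (2 * π / 3) ∧ p ∈ wedge q (θ q) (2 * π / 3) := by
  by_contra! hno
  have hno' : ∀ p ∈ ({p₀, p₁, p₂} : Set Pl), ∀ q ∈ ({q₀, q₁, q₂} : Set Pl),
      ¬ (q ∈ wedge p (θ p) (2 * π / 3) ∧ p ∈ wedge q (θ q) (2 * π / 3)) :=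
    fun p h q h' hh => hno p h q h' hh.1 hh.2
  obtain ⟨d₀, d₁, d₂, c₀, c₁, c₂, L, u, v, hL, hv, hu, hu', hs⟩ := hp
  obtain ⟨d₀', d₁', d₂', c₀', c₁', c₂', L', u', v', hL', hv', hw, hw', hs'⟩ := hq
  have comm : ∀ s, r + β + π + s = r + β + s + π := fun s => by ring
  have comm' : ∀ s t, r + β + s + π + t = r + β + s + t + π := fun s t => by ring
  simp only [comm, comm', cross_add_pi, neg_le_neg_iff] at c₀' c₁' c₂' hs'
  have first : ∀ {p p' q q' : Pl} {s : ℝ}, p ∈ ({p₀, p₁, p₂} : Set Pl) →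
      q ∈ ({q₀, q₁, q₂} : Set Pl) → cross s p ≤ cross s p' → cross (s + β) q ≤ cross (s + β) q' →
      dir (θ p) = dir (s + π / 3) → dir (θ q) = dir (s + β + 2 * π / 3) →
      (cross (s + β) q' < cross (s + β) p → cross s q < cross s p) ∧
        (cross s p' < cross s q → cross (s + β) p < cross (s + β) q) := by
    intro p p' q q' s hp hq cp cq ep eq
    rcases hβ.eq_or_lt with h0 | h0
    · subst h0
      rw [add_zero] at cq ⊢
      constructor <;> intro <;> linarith
    have : cross s q < cross s p ∨ cross (s + β) p < cross (s + β) q := by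
      by_contra! hc
      exact hno' p hp q hq (mutual_of_cross h0 hβ'.le ep eq hc.1 hc.2)
    constructor
    · intro h
      exact this.resolve_right (by linarith)
    · intro h
      exact this.resolve_left (by linarith)
  have second : ∀ {p q : Pl} {s s' : ℝ}, p ∈ ({p₀, p₁, p₂} : Set Pl) →
      q ∈ ({q₀, q₁, q₂} : Set Pl) → s' = s + (2 * π / 3 - β) →
      dir (θ p) = dir (s' - π / 3) → dir (θ q) = dir (s + 4 * π / 3) →
      cross s q < cross s p ∨ cross s' p < cross s' q := by
    intro p q s s' hp hq es ep eq
    by_contra! hc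
    refine hno' p hp q hq (mutual_of_cross (r := s + π) (γ := 2 * π / 3 - β) (by linarith)
      (by linarith) ?_ ?_ ?_ ?_).symm
    · rw [eq]; congr 1; ring
    · rw [ep, es, ← dir_add_two_pi]; congr 1; ring
    · rw [cross_add_pi, cross_add_pi]; linarith
    · rw [add_right_comm, ← es, cross_add_pi, cross_add_pi]; linarith
  have comm₂ : ∀ s, r + s + β = r + β + s := fun s => by ring
  have X₀ := first (by simp) (by simp) c₀ c₀' d₀ (by
    rw [d₂', ← dir_add_two_pi (r + β + 2 * π / 3)]; congr 1; ring)
  have X₁ := first (q := q₀) (q' := q₁) (by simp) (by simp) c₁ (by rwa [comm₂]) d₁ (by rw [d₀']; congr 1; ring)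
  have X₂ := first (q := q₁) (q' := q₂) (by simp) (by simp) c₂ (by rwa [comm₂]) d₂ (by rw [d₁']; congr 1; ring)
  rw [comm₂] at X₁ X₂
  have Y₀ := second (s := r + β) (s' := r + 2 * π / 3) (p := p₀) (q := q₀) (by simp) (by simp)
    (by ring) (by rw [d₀]; congr 1; ring) (by rw [d₀']; congr 1; ring)
  have Y₁ := second (s := r + β + 2 * π / 3) (s' := r + 4 * π / 3) (p := p₁) (q := q₁) (by simp)
    (by simp) (by ring) (by rw [d₁]; congr 1; ring) (by rw [d₁']; congr 1; ring)
  have Y₂ := second (s := r + β + 4 * π / 3) (s' := r + 2 * π) (p := p₂) (q := q₂) (by simp)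
    (by simp) (by ring) (by rw [d₂]; congr 1; ring) (by rw [d₂']; congr 1; ring)
  rw [cross_add_two_pi, cross_add_two_pi] at Y₂
  have P₀ := hs 0
  have P₁ := hs (2 * π / 3)
  have Pβ := hs β
  have Q₀ := hs' 0
  have Q₁ := hs' (2 * π / 3)
  have Qβ := hs' (2 * π / 3 - β)
  have a₁ : r + β + (2 * π / 3 - β) = r + 2 * π / 3 := by ring
  have a₂ : ∀ s, s + 2 * π / 3 + 2 * π / 3 = s + 4 * π / 3 := fun s => by ring
  have a₃ : ∀ s, s + 2 * π / 3 + 4 * π / 3 = s + 2 * π := fun s => by ring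
  rw [add_zero, sin_zero, cos_zero, add_zero, mul_zero, mul_one] at P₀ Q₀
  rw [a₂, a₃, cross_add_two_pi] at P₁ Q₁
  rw [a₁, a₂, a₃, cross_add_two_pi] at Qβ
  have hs3 : 0 < sin (π / 3) := sin_pos_of_pos_of_lt_pi (by linarith [pi_pos]) (by linarith [pi_pos])
  have := mul_pos hL hs3
  have := mul_pos hL' hs3
  rcases Y₀ with h₀ | h₀
  · have g₀ := X₀.1 h₀
    have h₂ := Y₂.resolve_right (by linarith)
    have g₂ := X₂.1 h₂
    have h₁ := Y₁.resolve_right (by linarith)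
    have g₁ := X₁.1 h₁
    exact not_both_pos hβ hβ'.le hL hv hu' hL' hv' hw' (by linarith) (by linarith)
  · have g₁ := X₁.2 h₀
    have h₁ := Y₁.resolve_left (by linarith)
    have g₂ := X₂.2 h₁
    have h₂ := Y₂.resolve_left (by linarith)
    have g₀ := X₀.2 h₂
    exact not_both_lt hβ hβ'.le hL hv hu hL' hv' hw (by linarith) (by linarith)

end Spread

/-- Coordinates of a gadget in a frame with origin `b` and first axis along `bc`. -/
theorem gadget.exists_frame {a b c : Pl} {θa θb θc : ℝ} (h : gadget a b c θa θb θc) :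
    ∃ φ L u v : ℝ, 0 < L ∧ 0 ≤ v ∧ L ≤ 2 * u ∧ u ≤ L ∧ v ≤ √3 * u ∧
      θb = φ ∧ θc = φ + 2 * π / 3 ∧ θa = φ + 4 * π / 3 ∧
      (∀ ψ, cross (φ + ψ) c = cross (φ + ψ) b - L * sin ψ) ∧
      ∀ ψ, cross (φ + ψ) a = cross (φ + ψ) b - u * sin ψ + v * cos ψ := by
  obtain ⟨hind, hbc, hca, φ, hφ, ha, hθb, hθc, hθa⟩ := h
  have hcol : ¬ Collinear ℝ ({a, b, c} : Set Pl) := affineIndependent_iff_not_collinear_set.1 hind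
  have h₁ : dist a c ≤ dist a b := by
    rw [EuclideanGeometry.angle_comm b c a] at hbc
    refine (EuclideanGeometry.angle_le_iff_dist_le ?_).1 hbc
    rwa [show ({a, c, b} : Set Pl) = {a, b, c} by grind]
  have h₂ : dist b a ≤ dist b c := by
    rw [EuclideanGeometry.angle_comm c a b] at hca
    refine (EuclideanGeometry.angle_le_iff_dist_le ?_).1 (hca)
    rwa [show ({b, a, c} : Set Pl) = {a, b, c} by grind]
  have hne : c ≠ b := by
    rintro rfl
    exact hcol (by simpa using collinear_pair ℝ a c)
  obtain ⟨L, hL⟩ : ∃ L, L = ‖c - b‖ := ⟨_, rfl⟩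
  rw [← hL] at hφ
  have L0 : 0 < L := hL ▸ norm_pos_iff.2 (sub_ne_zero.2 hne)
  obtain ⟨u, hu⟩ : ∃ u, u = cos φ * (a 0 - b 0) + sin φ * (a 1 - b 1) := ⟨_, rfl⟩
  obtain ⟨v, hv⟩ : ∃ v, v = cos φ * (a 1 - b 1) - sin φ * (a 0 - b 0) := ⟨_, rfl⟩
  have hc0 : c 0 = b 0 + L * cos φ := by
    have := congrArg (fun w : Pl => w 0) hφ
    simp only [PiLp.sub_apply, PiLp.smul_apply, dir_zero, smul_eq_mul] at this
    linarith
  have hc1 : c 1 = b 1 + L * sin φ := by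
    have := congrArg (fun w : Pl => w 1) hφ
    simp only [PiLp.sub_apply, PiLp.smul_apply, dir_one, smul_eq_mul] at this
    linarith
  have hcs := sin_sq_add_cos_sq φ
  have ha0 : a 0 = b 0 + u * cos φ - v * sin φ := by
    rw [hu, hv]; linear_combination (b 0 - a 0) * hcs
  have ha1 : a 1 = b 1 + u * sin φ + v * cos φ := by
    rw [hu, hv]; linear_combination (b 1 - a 1) * hcs
  have v0 : 0 ≤ v := by
    simp only [dir_zero, dir_one, cos_add_pi_div_two, sin_add_pi_div_two, PiLp.sub_apply] at ha
    rw [hv]; linarith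
  have nab : ‖a - b‖ ^ 2 = u ^ 2 + v ^ 2 := by
    rw [norm_sq_eq, PiLp.sub_apply, PiLp.sub_apply, ha0, ha1]
    linear_combination (u ^ 2 + v ^ 2) * hcs
  have nac : ‖a - c‖ ^ 2 = (u - L) ^ 2 + v ^ 2 := by
    rw [norm_sq_eq, PiLp.sub_apply, PiLp.sub_apply, ha0, ha1, hc0, hc1]
    linear_combination ((u - L) ^ 2 + v ^ 2) * hcs
  rw [dist_eq_norm, dist_eq_norm] at h₁
  rw [dist_comm b a, dist_comm b c, dist_eq_norm, dist_eq_norm, ← hL] at h₂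
  have u1 : L ≤ 2 * u := by
    have := pow_le_pow_left₀ (norm_nonneg _) h₁ 2
    rw [nab, nac] at this
    refine le_of_mul_le_mul_left ?_ L0
    linarith
  have hL2 := pow_le_pow_left₀ (norm_nonneg _) h₂ 2
  rw [nab] at hL2
  have u2 : u ≤ L := le_of_sq_le_sq (by linarith [sq_nonneg v]) L0.le
  have v3 : v ≤ √3 * u := by
    have hLu : L ^ 2 ≤ (2 * u) ^ 2 := pow_le_pow_left₀ L0.le u1 2
    refine le_of_sq_le_sq ?_ (mul_nonneg (sqrt_nonneg 3) (by linarith))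
    rw [mul_pow, sq_sqrt (by norm_num)]
    linarith
  have crossc : ∀ ψ, cross (φ + ψ) c = cross (φ + ψ) b - L * sin ψ := by
    intro ψ
    rw [cross, cross, hc0, hc1, cos_add, sin_add]
    linear_combination (-L * sin ψ) * hcs
  have crossa : ∀ ψ, cross (φ + ψ) a = cross (φ + ψ) b - u * sin ψ + v * cos ψ := by
    intro ψ
    rw [cross, cross, ha0, ha1, cos_add, sin_add]
    linear_combination (-u * sin ψ + v * cos ψ) * hcs
  exact ⟨φ, L, u, v, L0, v0, u1, u2, v3, hθb, hθc, hθa, crossc, crossa⟩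

theorem gadget.exists_spread {a b c : Pl} {θ : Pl → ℝ} (h : gadget a b c (θ a) (θ b) (θ c)) :
    ∃ r, Spread θ b c a r := by
  obtain ⟨φ, L, u, v, L0, v0, u1, u2, v3, hθb, hθc, hθa, crossc, crossa⟩ := h.exists_frame
  have hs3 : 0 < √3 := by positivity
  have e₁ : φ - π / 3 + 2 * π / 3 = φ + π / 3 := by ring
  have e₂ : φ - π / 3 + 4 * π / 3 = φ + π := by ring
  refine ⟨φ - π / 3, ?_, ?_, ?_, ?_, ?_, ?_, L, u, v, L0, v0, u1, u2, fun ψ => ?_⟩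
  · rw [hθb, sub_add_cancel]
  · rw [hθc]; congr 1; ring
  · rw [hθa]; congr 1; ring
  · rw [sub_eq_add_neg, crossa, sin_neg, cos_neg, sin_pi_div_three, cos_pi_div_three]
    nlinarith
  · rw [e₁, crossc, sin_pi_div_three]
    linarith [mul_pos L0 hs3]
  · rw [e₂, crossa, crossc, sin_pi, cos_pi]
    linarith
  · have hsum := cross_add_third (φ - π / 3 + ψ) b
    have e₃ : φ - π / 3 + ψ + 2 * π / 3 = φ + (π / 3 + ψ) := by ring
    have e₄ : φ - π / 3 + ψ + 4 * π / 3 = φ + (ψ + π) := by ring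
    rw [e₃, e₄] at hsum ⊢
    rw [crossc, crossa, sin_add_pi, cos_add_pi]
    linarith

theorem exists_mutual_of_gadget {a b c x y z : Pl} {θ : Pl → ℝ}
    (h₁ : gadget a b c (θ a) (θ b) (θ c)) (h₂ : gadget x y z (θ x) (θ y) (θ z)) :
    ∃ p ∈ ({a, b, c} : Set Pl), ∃ q ∈ ({x, y, z} : Set Pl),
      q ∈ wedge p (θ p) (2 * π / 3) ∧ p ∈ wedge q (θ q) (2 * π / 3) := by
  obtain ⟨r, hr⟩ := h₁.exists_spread
  obtain ⟨s, hs⟩ := h₂.exists_spread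
  have h3 : (0 : ℝ) < 2 * π / 3 := by positivity
  obtain ⟨n, hn, -⟩ := existsUnique_add_zsmul_mem_Ico h3 (s - π - r) 0
  rw [zero_add, zsmul_eq_mul] at hn
  obtain ⟨q₀, q₁, q₂, hset, hq⟩ := hs.exists_rotate n
  obtain ⟨p, hp, q, hq, hpq⟩ := hr.exists_mutual
    (β := s - π - r + n * (2 * π / 3)) (by convert hq using 1; ring) hn.1 hn.2
  refine ⟨p, ?_, q, ?_, hpq⟩
  · simp only [Set.mem_insert_iff, Set.mem_singleton_iff] at hp ⊢
    tauto
  · rw [hset] at hq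
    simp only [Set.mem_insert_iff, Set.mem_singleton_iff] at hq ⊢
    tauto

theorem gadget.mutual {a b c : Pl} {θ : Pl → ℝ} (h : gadget a b c (θ a) (θ b) (θ c)) :
    (a ∈ wedge b (θ b) (2 * π / 3) ∧ b ∈ wedge a (θ a) (2 * π / 3)) ∧
      (c ∈ wedge b (θ b) (2 * π / 3) ∧ b ∈ wedge c (θ c) (2 * π / 3)) := by
  obtain ⟨φ, L, u, v, L0, v0, u1, u2, v3, hθb, hθc, hθa, crossc, crossa⟩ := h.exists_frame
  have hL3 : 0 < L * √3 := by positivity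
  have e₁ : φ - π / 3 + 2 * π / 3 = φ + π / 3 := by ring
  have e₂ : φ + π + 2 * π / 3 = φ + -(π / 3) + 2 * π := by ring
  have e₃ : φ + π / 3 + 2 * π / 3 = φ + π := by ring
  have a₁ := crossa (π / 3)
  have a₂ := crossa (-(π / 3))
  have a₃ := crossa π
  have c₁ := crossc (π / 3)
  have c₂ := crossc (-(π / 3))
  have c₃ := crossc π
  simp only [sin_neg, cos_neg, sin_pi_div_three, cos_pi_div_three, sin_pi, cos_pi]
    at a₁ a₂ a₃ c₁ c₂ c₃
  refine ⟨⟨?_, ?_⟩, ?_, ?_⟩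
  · refine mem_wedge_of_cross (r := φ - π / 3) (by rw [hθb, sub_add_cancel]) ?_ ?_
    · rw [sub_eq_add_neg]
      linarith
    · rw [e₁]
      linarith
  · refine mem_wedge_of_cross (r := φ + π) (by rw [hθa]; congr 1; ring) ?_ ?_
    · linarith
    · rw [e₂, cross_add_two_pi, cross_add_two_pi]
      linarith
  · refine mem_wedge_of_cross (r := φ - π / 3) (by rw [hθb, sub_add_cancel]) ?_ ?_
    · rw [sub_eq_add_neg]
      linarith
    · rw [e₁]
      linarith
  · refine mem_wedge_of_cross (r := φ + π / 3) (by rw [hθc]; congr 1; ring) ?_ ?_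
    · linarith
    · rw [e₃]
      linarith

/-- Main connectivity theorem: if the 2π/3-wedges of two triplets of points are
oriented, independently, according to the gadget construction, then the induced
mutual-coverage graph on the six points is connected. -/
theorem stmt18 (a b c x y z : Pl)
    (hdist : Function.Injective ![a, b, c, x, y, z])
    (θ : Pl → ℝ)
    (h₁ : gadget a b c (θ a) (θ b) (θ c))
    (h₂ : gadget x y z (θ x) (θ y) (θ z)) :
    ∀ p ∈ ({a, b, c, x, y, z} : Set Pl), ∀ q ∈ ({a, b, c, x, y, z} : Set Pl),
      Relation.ReflTransGen
        (fun u v => u ∈ ({a, b, c, x, y, z} : Set Pl) ∧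
          v ∈ ({a, b, c, x, y, z} : Set Pl) ∧
          u ∈ wedge v (θ v) (2 * π / 3) ∧ v ∈ wedge u (θ u) (2 * π / 3)) p q := by
  set S : Set Pl := {a, b, c, x, y, z} with hS
  set R : Pl → Pl → Prop := fun u v => u ∈ S ∧ v ∈ S ∧
    u ∈ wedge v (θ v) (2 * π / 3) ∧ v ∈ wedge u (θ u) (2 * π / 3) with hR
  have symm : ∀ {u v}, R u v → R v u := fun h => ⟨h.2.1, h.1, h.2.2.2, h.2.2.1⟩
  have ab : R a b := ⟨by simp [hS], by simp [hS], h₁.mutual.1⟩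
  have cb : R c b := ⟨by simp [hS], by simp [hS], h₁.mutual.2⟩
  have xy : R x y := ⟨by simp [hS], by simp [hS], h₂.mutual.1⟩
  have zy : R z y := ⟨by simp [hS], by simp [hS], h₂.mutual.2⟩
  have toB : ∀ p ∈ ({a, b, c} : Set Pl), Relation.ReflTransGen R p b := by
    rintro p (rfl | rfl | rfl)
    exacts [.single ab, .refl, .single cb]
  have toY : ∀ q ∈ ({x, y, z} : Set Pl), Relation.ReflTransGen R q y := by
    rintro q (rfl | rfl | rfl)
    exacts [.single xy, .refl, .single zy]
  have rsymm : ∀ {u v}, Relation.ReflTransGen R u v → Relation.ReflTransGen R v u := by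
    intro u v h
    induction h with
    | refl => exact .refl
    | tail _ h ih => exact ih.head (symm h)
  obtain ⟨p, hp, q, hq, hpq⟩ := exists_mutual_of_gadget h₁ h₂
  have pq : R p q := by
    refine ⟨?_, ?_, hpq.2, hpq.1⟩
    · rcases hp with rfl | rfl | rfl <;> simp [hS]
    · rcases hq with rfl | rfl | rfl <;> simp [hS]
  have yb : Relation.ReflTransGen R y b :=
    ((rsymm (toY q hq)).tail (symm pq)).trans (toB p hp)
  have all : ∀ p ∈ S, Relation.ReflTransGen R p b := by
    rintro p (rfl | rfl | rfl | rfl | rfl | rfl)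
    exacts [.single ab, .refl, .single cb, (Relation.ReflTransGen.single xy).trans yb, yb,
      (Relation.ReflTransGen.single zy).trans yb]
  exact fun p hp q hq => (all p hp).trans (rsymm (all q hq))
end
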